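/- arXiv:2604.04954 — 17 statements merged into one kernel-verified Lean document; each statement's English description precedes it below -/
import Mathlib

section
/- Let R be a commutative ring in which 2 is a unit, let M be an R-module, and let N be a proper submodule of M. Then N is a gsdf-absorbing submodule of M if and only if N is a classical primary submodule of M. -/
/-- A proper submodule `N` of an `R`-module `M` is *gsdf-absorbing* if for all `u v : R` and
`x : M`, `(u^2 - v^2) • x ∈ N` implies `(u - v) • x ∈ N` or `(u + v)^k • x ∈ N` for some
`k ≥ 1`. -/
def IsGsdfAbsorbing {R : Type*} [CommRing R] {M : Type*} [AddCommGroup M] [Module R M]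
    (N : Submodule R M) : Prop :=
  N ≠ ⊤ ∧ ∀ (u v : R) (x : M), (u ^ 2 - v ^ 2) • x ∈ N →
    (u - v) • x ∈ N ∨ ∃ k : ℕ, 1 ≤ k ∧ (u + v) ^ k • x ∈ N

/-- A proper submodule `N` of an `R`-module `M` is *classical primary* if for all `u v : R` and
`x : M`, `(u * v) • x ∈ N` implies `u • x ∈ N` or `v^k • x ∈ N` for some `k ≥ 1`. -/
def IsClassicalPrimary {R : Type*} [CommRing R] {M : Type*} [AddCommGroup M] [Module R M]
    (N : Submodule R M) : Prop :=
  N ≠ ⊤ ∧ ∀ (u v : R) (x : M), (u * v) • x ∈ N →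
    u • x ∈ N ∨ ∃ k : ℕ, 1 ≤ k ∧ v ^ k • x ∈ N

theorem gsdf_iff_classicalPrimary_of_two_isUnit {R : Type*} [CommRing R] {M : Type*}
    [AddCommGroup M] [Module R M] (h2 : IsUnit (2 : R)) (N : Submodule R M) (hN : N ≠ ⊤) :
    IsGsdfAbsorbing N ↔ IsClassicalPrimary N := by
  obtain ⟨c, hc⟩ := h2.exists_right_inv
  constructor
  · rintro ⟨_, h⟩
    refine ⟨hN, fun u v x hx => ?_⟩
    have e1 : c * (u + v) - c * (v - u) = u := by linear_combination u * hc
    have e2 : c * (u + v) + c * (v - u) = v := by linear_combination v * hc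
    have e3 : (c * (u + v)) ^ 2 - (c * (v - u)) ^ 2 = u * v := by
      rw [sq_sub_sq, e1, e2, mul_comm]
    have := h (c * (u + v)) (c * (v - u)) x (by rw [e3]; exact hx)
    rwa [e1, e2] at this
  · rintro ⟨_, h⟩
    refine ⟨hN, fun u v x hx => h (u - v) (u + v) x ?_⟩
    rwa [mul_comm, ← sq_sub_sq]
end

section
/- Let R be a commutative ring, M an R-module, and N a proper submodule of M. Then N is a gsdf-absorbing submodule of M if and only if for every r ∈ R with rM ⊄ N, the submodule (N :_M r) = {x ∈ M : rx ∈ N} is a gsdf-absorbing submodule of M. -/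
/-- `N` is gsdf-absorbing iff for every `r : R` with `r • M ⊄ N`, the submodule
`(N :_M r) = {x : M | r • x ∈ N}` is gsdf-absorbing. -/
theorem gsdf_iff_forall_colon_smul {R : Type*} [CommRing R] {M : Type*}
    [AddCommGroup M] [Module R M] (N : Submodule R M) (hN : N ≠ ⊤) :
    IsGsdfAbsorbing N ↔
      ∀ r : R, (∃ x : M, r • x ∉ N) →
        IsGsdfAbsorbing (N.comap (LinearMap.lsmul R M r)) := by
  constructor
  · rintro ⟨_, h⟩ r ⟨x, hx⟩
    refine ⟨fun ht => hx ?_, fun u v y hy => ?_⟩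
    · have : x ∈ N.comap (LinearMap.lsmul R M r) := ht ▸ Submodule.mem_top
      simpa using this
    · simp only [Submodule.mem_comap, LinearMap.lsmul_apply] at hy ⊢
      simp only [smul_comm r] at hy ⊢
      exact h u v (r • y) hy
  · intro h
    have h1 := h 1 (by
      by_contra! hc
      exact hN (eq_top_iff.2 fun x _ => by simpa using hc x))
    have e : N.comap (LinearMap.lsmul R M 1) = N := by
      ext x
      simp
    rwa [e] at h1
end

section
/- Let R be a commutative ring, M an R-module, and N a proper submodule of M. Then N is a gsdf-absorbing submodule of M if and only if for every finitely generated submodule K of M with K ⊄ N, the ideal (N :_R K) = {r ∈ R : rK ⊆ N} is an sdf-absorbing primary ideal of R. -/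
/-- A proper ideal `I` of `R` is *sdf-absorbing primary* if for all `u v : R`,
`u^2 - v^2 ∈ I` implies `u - v ∈ I` or `(u + v)^k ∈ I` for some `k ≥ 1`. -/
def IsSdfAbsorbingPrimary {R : Type*} [CommRing R] (I : Ideal R) : Prop :=
  I ≠ ⊤ ∧ ∀ u v : R, u ^ 2 - v ^ 2 ∈ I →
    u - v ∈ I ∨ ∃ k : ℕ, 1 ≤ k ∧ (u + v) ^ k ∈ I

/-- `N` is gsdf-absorbing iff for every finitely generated submodule `K ⊄ N`, the ideal
`(N :_R K) = {r : R | r • K ⊆ N}` is sdf-absorbing primary. -/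
theorem gsdf_iff_forall_colon_fg {R : Type*} [CommRing R] {M : Type*}
    [AddCommGroup M] [Module R M] (N : Submodule R M) (hN : N ≠ ⊤) :
    IsGsdfAbsorbing N ↔
      ∀ K : Submodule R M, K.FG → ¬ K ≤ N → IsSdfAbsorbingPrimary (N.colon K) := by
  constructor
  · rintro ⟨-, h⟩ K hK hKN
    refine ⟨?_, ?_⟩
    · intro ht
      apply hKN
      intro x hx
      have h1 : (1 : R) ∈ N.colon (K : Set M) := by rw [ht]; trivial
      have := Submodule.mem_colon.1 h1 x hx
      simpa using this
    · intro u v huv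
      have huv' : ∀ x ∈ K, (u ^ 2 - v ^ 2) • x ∈ N := fun x hx => Submodule.mem_colon.1 huv x hx
      by_cases hA : ∀ x ∈ K, (u - v) • x ∈ N
      · exact Or.inl (Submodule.mem_colon.2 hA)
      right
      push Not at hA
      obtain ⟨x, hx, hxA⟩ := hA
      have mono : ∀ (a b : ℕ) (z : M), a ≤ b → (u + v) ^ a • z ∈ N → (u + v) ^ b • z ∈ N := by
        intro a b z hab hz
        obtain ⟨c, rfl⟩ := Nat.exists_eq_add_of_le' hab
        rw [pow_add, mul_smul]
        exact N.smul_mem _ hz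
      have hB : ∀ y ∈ K, ∃ k : ℕ, (u + v) ^ k • y ∈ N := by
        intro y hy
        rcases h u v y (huv' y hy) with hyA | ⟨k, -, hk⟩
        · obtain ⟨a, -, ha⟩ := (h u v x (huv' x hx)).resolve_left hxA
          have hxy : (u - v) • (x + y) ∉ N := by
            rw [smul_add]
            intro hc
            exact hxA ((N.add_mem_iff_left hyA).1 hc)
          obtain ⟨b, -, hb⟩ := (h u v (x + y) (huv' _ (K.add_mem hx hy))).resolve_left hxy
          refine ⟨a + b, ?_⟩
          have h1 := mono a (a + b) x (by omega) ha
          have h2 := mono b (a + b) (x + y) (by omega) hb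
          rw [smul_add] at h2
          exact (N.add_mem_iff_right h1).1 h2
        · exact ⟨k, hk⟩
      obtain ⟨s, rfl⟩ := hK
      have hB' : ∀ y : M, ∃ k : ℕ, y ∈ s → (u + v) ^ k • y ∈ N := by
        intro y
        by_cases hy : y ∈ s
        · obtain ⟨k, hk⟩ := hB y (Submodule.subset_span hy)
          exact ⟨k, fun _ => hk⟩
        · exact ⟨0, fun h => absurd h hy⟩
      choose f hf using hB'
      refine ⟨s.sup f + 1, by omega, Submodule.mem_colon.2 ?_⟩
      intro y hy
      have hle : Submodule.span R (s : Set M) ≤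
          N.comap (LinearMap.lsmul R M ((u + v) ^ (s.sup f + 1))) := by
        rw [Submodule.span_le]
        intro z hz
        exact mono (f z) _ z (Nat.le_succ_of_le (Finset.le_sup (f := f) hz)) (hf z hz)
      exact hle hy
  · intro h
    refine ⟨hN, fun u v x hx => ?_⟩
    by_cases hxN : x ∈ N
    · exact Or.inl (N.smul_mem _ hxN)
    have key : ∀ r : R, r ∈ N.colon (Submodule.span R {x} : Set M) ↔ r • x ∈ N := by
      intro r
      rw [Submodule.mem_colon]
      refine ⟨fun h => h x (Submodule.mem_span_singleton_self x), fun h y hy => ?_⟩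
      obtain ⟨c, rfl⟩ := Submodule.mem_span_singleton.1 hy
      rw [smul_comm]
      exact N.smul_mem _ h
    have := (h (Submodule.span R {x}) (Submodule.fg_span_singleton x)
      (fun hle => hxN (hle (Submodule.mem_span_singleton_self x)))).2 u v ((key _).2 hx)
    simpa only [key] using this
end

section
/- Let R be a commutative ring and M an R-module. If N is a gsdf-absorbing submodule of M that is not properly contained in any gsdf-absorbing submodule of M, then N is a prime submodule of M. -/
/-- A proper submodule `N` of `M` is *prime* if `u • x ∈ N` implies `x ∈ N` or `u • M ⊆ N`. -/
def IsPrimeSubmodule {R : Type*} [CommRing R] {M : Type*} [AddCommGroup M] [Module R M]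
    (N : Submodule R M) : Prop :=
  N ≠ ⊤ ∧ ∀ (u : R) (x : M), u • x ∈ N → x ∈ N ∨ ∀ y : M, u • y ∈ N

/-- Any maximal gsdf-absorbing submodule of `M` is prime. -/
theorem maximal_gsdf_isPrime {R : Type*} [CommRing R] {M : Type*}
    [AddCommGroup M] [Module R M] (N : Submodule R M) (hN : IsGsdfAbsorbing N)
    (hmax : ∀ N' : Submodule R M, IsGsdfAbsorbing N' → ¬ N < N') :
    IsPrimeSubmodule N := by
  refine ⟨hN.1, fun u x hx => ?_⟩
  by_cases htop : N.comap (LinearMap.lsmul R M u) = ⊤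
  · right
    intro y
    have hy : y ∈ N.comap (LinearMap.lsmul R M u) := htop ▸ Submodule.mem_top
    simpa using hy
  · left
    by_contra hxN
    refine hmax (N.comap (LinearMap.lsmul R M u)) ⟨htop, fun a b y hy => ?_⟩ ?_
    · simp only [Submodule.mem_comap, LinearMap.lsmul_apply] at hy ⊢
      rw [smul_comm] at hy
      rcases hN.2 a b (u • y) hy with h | ⟨k, hk, h⟩
      · left
        rwa [smul_comm]
      · right
        refine ⟨k, hk, ?_⟩
        rwa [smul_comm]
    · refine lt_of_le_of_ne (fun y hy => ?_) (fun h => hxN ?_)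
      · simpa using N.smul_mem u hy
      · rw [h]
        simpa using hx
end

section
/- Let R be a commutative ring, I = (a) a principal ideal of R, M an R-module, and N a proper submodule of the R-module IM. Then N is a gsdf-absorbing submodule of the R-module IM if and only if (N :_M I) = {x ∈ M : Ix ⊆ N} is a gsdf-absorbing submodule of M. -/
/-- The submodule `(N :_M I) = {x : M | i • x ∈ N for all i ∈ I}`. -/
def Submodule.colonIdeal {R : Type*} [CommRing R] {M : Type*} [AddCommGroup M] [Module R M]
    (N : Submodule R M) (I : Ideal R) : Submodule R M where
  carrier := {x : M | ∀ i ∈ I, i • x ∈ N}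
  zero_mem' := fun i _ => by simp
  add_mem' := fun {x y} hx hy i hi => by
    simpa [smul_add] using N.add_mem (hx i hi) (hy i hi)
  smul_mem' := fun c x hx i hi => by
    rw [smul_comm]
    exact N.smul_mem c (hx i hi)

/-- Let `I = (a)` be a principal ideal of `R`, `M` an `R`-module, and `N` a proper submodule of
`IM`.  Then `N` is gsdf-absorbing in the `R`-module `IM` if and only if `(N :_M I)` is a
gsdf-absorbing submodule of `M`. -/
theorem gsdf_in_IM_iff_colon_gsdf {R : Type*} [CommRing R] {M : Type*}
    [AddCommGroup M] [Module R M] (a : R) (N : Submodule R M)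
    (hle : N ≤ (Ideal.span {a} : Ideal R) • (⊤ : Submodule R M))
    (hne : N ≠ (Ideal.span {a} : Ideal R) • (⊤ : Submodule R M)) :
    (∀ (u v : R) (x : M), x ∈ (Ideal.span {a} : Ideal R) • (⊤ : Submodule R M) →
        (u ^ 2 - v ^ 2) • x ∈ N →
        (u - v) • x ∈ N ∨ ∃ k : ℕ, 1 ≤ k ∧ (u + v) ^ k • x ∈ N) ↔
      IsGsdfAbsorbing (N.colonIdeal (Ideal.span {a})) := by
  have mem : ∀ x : M, x ∈ N.colonIdeal (Ideal.span {a}) ↔ a • x ∈ N := by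
    intro x
    constructor
    · intro h
      exact h a (Ideal.mem_span_singleton_self a)
    · intro h i hi
      obtain ⟨c, rfl⟩ := Ideal.mem_span_singleton'.mp hi
      rw [mul_smul]
      exact N.smul_mem c h
  have memI : ∀ x : M, x ∈ (Ideal.span {a} : Ideal R) • (⊤ : Submodule R M) ↔
      ∃ y : M, a • y = x := by
    intro x
    rw [Submodule.ideal_span_singleton_smul, Submodule.mem_smul_pointwise_iff_exists]
    simp
  constructor
  · intro h
    refine ⟨?_, ?_⟩
    · intro ht
      apply hne
      apply le_antisymm hle
      intro x hx
      obtain ⟨y, rfl⟩ := (memI x).1 hx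
      exact (mem y).1 (ht ▸ Submodule.mem_top)
    · intro u v x hx
      simp only [mem, smul_comm a] at hx ⊢
      exact h u v (a • x) ((memI _).2 ⟨x, rfl⟩) hx
  · rintro ⟨-, h⟩ u v x hx hN
    obtain ⟨y, rfl⟩ := (memI x).1 hx
    have := h u v y
    simp only [mem, smul_comm a] at this
    exact this hN
end

section
/- Let n ≥ 2 be an integer. If the zero submodule {0} is a gsdf-absorbing submodule of the ℤ-module ℤ/nℤ, then n has at most one odd prime divisor. -/
/-- If `{0}` is gsdf-absorbing in the `ℤ`-module `ℤ/nℤ`, then `n` has at most one odd prime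
divisor. -/
theorem zero_gsdf_at_most_one_odd_prime (n : ℕ) (hn : 2 ≤ n)
    (h : IsGsdfAbsorbing (⊥ : Submodule ℤ (ZMod n))) :
    ∀ p q : ℕ, p.Prime → q.Prime → Odd p → Odd q → p ∣ n → q ∣ n → p = q := by
  intro p q hp hq op oq hpn hqn
  by_contra hne
  obtain ⟨m, rfl⟩ := ((Nat.coprime_primes hp hq).2 hne).mul_dvd_of_dvd_of_dvd hpn hqn
  have hm : (m : ℤ) ≠ 0 := by
    rintro h0
    have : m = 0 := by exact_mod_cast h0
    subst this
    simp at hn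
  obtain ⟨a, ha⟩ := op
  obtain ⟨b, hb⟩ := oq
  have key : ∀ c : ℤ, c • (m : ZMod (p * q * m)) ∈ (⊥ : Submodule ℤ (ZMod (p * q * m))) ↔
      ((p : ℤ) * q) ∣ c := by
    intro c
    rw [Submodule.mem_bot, zsmul_eq_mul]
    have : (c : ZMod (p * q * m)) * (m : ZMod (p * q * m))
        = ((c * m : ℤ) : ZMod (p * q * m)) := by push_cast; rfl
    rw [this, ZMod.intCast_zmod_eq_zero_iff_dvd]
    push_cast
    exact mul_dvd_mul_iff_right hm
  have h1 : ((a : ℤ) + b + 1) - ((b : ℤ) - a) = p := by rw [ha]; push_cast; ring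
  have h2 : ((a : ℤ) + b + 1) + ((b : ℤ) - a) = q := by rw [hb]; push_cast; ring
  have h3 := h.2 ((a : ℤ) + b + 1) ((b : ℤ) - a) (m : ZMod (p * q * m))
  rw [sq_sub_sq, h1, h2] at h3
  simp only [key] at h3
  rcases h3 (by rw [mul_comm]) with h4 | ⟨k, _, h4⟩
  · have h5 : (q : ℤ) ∣ p := (Dvd.intro_left _ rfl).trans h4
    exact hne ((Nat.prime_dvd_prime_iff_eq hq hp).1 (by exact_mod_cast h5)).symm
  · have h5 : (p : ℤ) ∣ (q : ℤ) ^ k := (Dvd.intro _ rfl).trans h4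
    have h6 : p ∣ q ^ k := by exact_mod_cast h5
    exact hne ((Nat.prime_dvd_prime_iff_eq hp hq).1 (hp.dvd_of_dvd_pow h6))
end

section
/- Let n = 2^k · p^s where k ≥ 2, s ≥ 1, and p is an odd prime. Then the zero submodule {0} is not a gsdf-absorbing submodule of the ℤ-module ℤ/nℤ. -/
/-- If `n = 2^k * p^s` with `k ≥ 2`, `s ≥ 1` and `p` an odd prime, then `{0}` is not a
gsdf-absorbing submodule of the `ℤ`-module `ℤ/nℤ`. -/
theorem zero_not_gsdf_of_two_pow (k s p : ℕ) (hk : 2 ≤ k) (hs : 1 ≤ s)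
    (hp : p.Prime) (hodd : Odd p) :
    ¬ IsGsdfAbsorbing (⊥ : Submodule ℤ (ZMod (2 ^ k * p ^ s))) := by
  rintro ⟨-, h⟩
  obtain ⟨j, rfl⟩ := Nat.exists_eq_add_of_le hk
  have key : ∀ a : ℤ, a • (1 : ZMod (2 ^ (2 + j) * p ^ s)) ∈
      (⊥ : Submodule ℤ (ZMod (2 ^ (2 + j) * p ^ s))) ↔ ((2 ^ (2 + j) * p ^ s : ℕ) : ℤ) ∣ a := by
    intro a
    rw [Submodule.mem_bot, zsmul_eq_mul, mul_one, ZMod.intCast_zmod_eq_zero_iff_dvd]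
  have hpos : (0 : ℤ) < 2 ^ j * (p : ℤ) ^ s := by
    have : (0 : ℤ) < p := by exact_mod_cast hp.pos
    positivity
  rcases h (1 + 2 ^ j * (p : ℤ) ^ s) (1 - 2 ^ j * (p : ℤ) ^ s) 1
    ((key _).2 ⟨1, by push_cast; ring⟩) with h1 | ⟨m, -, h2⟩
  · rw [key] at h1
    have h3 := Int.le_of_dvd (by linarith) h1
    push_cast at h3
    rw [pow_add] at h3
    linarith
  · rw [key] at h2
    have e : (1 + 2 ^ j * (p : ℤ) ^ s + (1 - 2 ^ j * (p : ℤ) ^ s)) ^ m = ((2 ^ m : ℕ) : ℤ) := by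
      push_cast
      congr 1
      ring
    rw [e, Int.natCast_dvd_natCast] at h2
    have h3 : p ∣ 2 ^ m := ((dvd_pow_self p (by omega)).trans (Dvd.intro_left _ rfl)).trans h2
    have h4 := (Nat.prime_dvd_prime_iff_eq hp Nat.prime_two).1 (hp.dvd_of_dvd_pow h3)
    subst h4
    exact absurd hodd (by decide)
end

section
/- Let n ≥ 2 be an integer. The zero submodule {0} is a gsdf-absorbing submodule of the ℤ-module ℤ/nℤ if and only if n = p^k for some prime p and integer k ≥ 1, or n = 2p^k for some odd prime p and integer k ≥ 1. -/
theorem gsdf_smul_mem (n : ℕ) (c : ℤ) (t : ℤ) :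
    c • ((t : ℤ) : ZMod n) ∈ (⊥ : Submodule ℤ (ZMod n)) ↔ (n : ℤ) ∣ c * t := by
  rw [Submodule.mem_bot, zsmul_eq_mul, ← Int.cast_mul, ZMod.intCast_zmod_eq_zero_iff_dvd]

theorem gsdf_ne_top (n : ℕ) (hn : 2 ≤ n) : (⊥ : Submodule ℤ (ZMod n)) ≠ ⊤ := by
  haveI : Fact (1 < n) := ⟨hn⟩
  exact bot_ne_top

theorem gsdf_pk (p k : ℕ) (hp : p.Prime) (a b t : ℤ) (h : ((p : ℤ) ^ k) ∣ a * b * t) :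
    ((p : ℤ) ^ k) ∣ a * t ∨ ((p : ℤ) ^ k) ∣ b ^ k := by
  by_cases hb : (p : ℤ) ∣ b
  · exact Or.inr (pow_dvd_pow_of_dvd hb k)
  · left
    have hc : IsCoprime ((p : ℤ) ^ k) b :=
      ((Nat.prime_iff_prime_int.mp hp).coprime_iff_not_dvd.mpr hb).pow_left
    apply hc.dvd_of_dvd_mul_left
    have e : b * (a * t) = a * b * t := by ring
    rwa [e]

theorem zero_gsdf_zmod_iff (n : ℕ) (hn : 2 ≤ n) :
    IsGsdfAbsorbing (⊥ : Submodule ℤ (ZMod n)) ↔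
      (∃ p k : ℕ, p.Prime ∧ 1 ≤ k ∧ n = p ^ k) ∨
      (∃ p k : ℕ, p.Prime ∧ Odd p ∧ 1 ≤ k ∧ n = 2 * p ^ k) := by
  constructor
  · rintro ⟨-, h⟩
    by_cases hodd : ∃ p : ℕ, p.Prime ∧ p ∣ n ∧ p ≠ 2
    · obtain ⟨p, hp, hpn, hp2⟩ := hodd
      have hpo : Odd p := hp.odd_of_ne_two hp2
      obtain ⟨k, m, hm, hnm⟩ := Nat.exists_eq_pow_mul_and_not_dvd (n := n) (by omega) p hp.ne_one
      have hk : 1 ≤ k := by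
        rcases Nat.eq_zero_or_pos k with h0 | h0
        · subst h0
          simp at hnm
          exact absurd (hnm ▸ hpn) hm
        · exact h0
      have hpk : 0 < p ^ k := pow_pos hp.pos k
      by_cases hm3 : m ∣ 2
      · rcases (Nat.dvd_prime Nat.prime_two).mp hm3 with h1 | h1
        · left; exact ⟨p, k, hp, hk, by rw [hnm, h1, mul_one]⟩
        · right; exact ⟨p, k, hp, hpo, hk, by rw [hnm, h1, mul_comm]⟩
      · exfalso
        have h' := h ((p : ℤ) ^ k + m) (m - (p : ℤ) ^ k) ((1 : ℤ) : ZMod n)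
        simp only [gsdf_smul_mem, mul_one] at h'
        have e1 : ((p : ℤ) ^ k + m) - (m - (p : ℤ) ^ k) = ((p ^ k * 2 : ℕ) : ℤ) := by
          push_cast; ring
        have e2 : ((p : ℤ) ^ k + m) + (m - (p : ℤ) ^ k) = ((2 * m : ℕ) : ℤ) := by
          push_cast; ring
        rw [e1, e2] at h'
        rcases h' ⟨4, by rw [hnm]; push_cast; ring⟩ with h1 | ⟨j, -, h1⟩
        · rw [Int.natCast_dvd_natCast, hnm] at h1
          exact hm3 (Nat.dvd_of_mul_dvd_mul_left hpk h1)
        · rw [← Nat.cast_pow, Int.natCast_dvd_natCast] at h1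
          have h2 := hp.dvd_of_dvd_pow (hpn.trans h1)
          rcases hp.dvd_mul.mp h2 with h3 | h3
          · exact hp2 ((Nat.prime_dvd_prime_iff_eq hp Nat.prime_two).mp h3)
          · exact hm h3
    · push Not at hodd
      left
      have := Nat.eq_prime_pow_of_unique_prime_dvd (n := n) (p := 2) (by omega)
        (fun {d} hd hdn => hodd d hd hdn)
      refine ⟨2, _, Nat.prime_two, ?_, this⟩
      by_contra h0
      have h0 : n.primeFactorsList.length = 0 := by omega
      rw [h0] at this
      omega
  · intro h
    refine ⟨gsdf_ne_top n hn, fun u v x => ?_⟩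
    obtain ⟨t, rfl⟩ := ZMod.intCast_surjective x
    simp only [gsdf_smul_mem]
    have e : u ^ 2 - v ^ 2 = (u - v) * (u + v) := by ring
    rw [e]
    intro hd
    rcases h with ⟨p, k, hp, hk, rfl⟩ | ⟨p, k, hp, hpo, hk, rfl⟩
    · push_cast at hd ⊢
      rcases gsdf_pk p k hp _ _ _ hd with h1 | h1
      · exact Or.inl h1
      · exact Or.inr ⟨k, hk, h1.mul_right t⟩
    · push_cast at hd ⊢
      have hco : IsCoprime (2 : ℤ) ((p : ℤ) ^ k) := by
        have := Nat.isCoprime_iff_coprime.mpr ((Nat.coprime_two_left.mpr hpo).pow_right k)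
        exact_mod_cast this
      have h2 : (2 : ℤ) ∣ (u - v) * (u + v) * t := (dvd_mul_right _ _).trans hd
      have h3 : (2 : ℤ) ∣ u - v ∧ (2 : ℤ) ∣ u + v ∨ (2 : ℤ) ∣ t := by
        rcases Int.prime_two.dvd_or_dvd h2 with h | h
        · left
          rcases Int.prime_two.dvd_or_dvd h with h | h <;> constructor <;> omega
        · exact Or.inr h
      rcases gsdf_pk p k hp _ _ _ ((dvd_mul_left _ _).trans hd) with h1 | h1
      · left
        refine hco.mul_dvd ?_ h1
        rcases h3 with h | h
        · exact h.1.mul_right t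
        · exact h.mul_left _
      · right
        refine ⟨k, hk, hco.mul_dvd ?_ (h1.mul_right t)⟩
        rcases h3 with h | h
        · exact (dvd_pow h.2 (by omega)).mul_right t
        · exact h.mul_left _
end

section
/- Let R be a commutative ring, S a multiplicatively closed subset of R, M an R-module, and N a proper submodule of M. If N is a gsdf-absorbing submodule of M and S⁻¹N ≠ S⁻¹M, then S⁻¹N is a gsdf-absorbing submodule of the S⁻¹R-module S⁻¹M. -/
theorem gsdf_aux_mem {R : Type*} [CommRing R] {M : Type*} [AddCommGroup M] [Module R M]
    (S : Submonoid R) (N : Submodule R M) (m : M) :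
    LocalizedModule.mkLinearMap S M m ∈ N.localized S ↔ ∃ t : S, (t : R) • m ∈ N := by
  rw [Submodule.mem_localized']
  constructor
  · rintro ⟨n, hn, s, h⟩
    rw [IsLocalizedModule.mk'_eq_iff, ← LinearMap.map_smul_of_tower,
      IsLocalizedModule.eq_iff_exists S] at h
    obtain ⟨c, hc⟩ := h
    refine ⟨c * s, ?_⟩
    have : ((c * s : S) : R) • m = (c : R) • n := by
      rw [Submonoid.coe_mul, mul_smul]; exact hc.symm
    rw [this]
    exact N.smul_mem _ hn
  · rintro ⟨t, ht⟩
    refine ⟨_, ht, t, ?_⟩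
    rw [IsLocalizedModule.mk'_eq_iff, map_smul]; rfl

theorem gsdf_aux_unit {R : Type*} [CommRing R] (S : Submonoid R) {V : Type*} [AddCommGroup V]
    [Module (Localization S) V] (P : Submodule (Localization S) V) (s : S) (y : V) :
    algebraMap R (Localization S) s • y ∈ P ↔ y ∈ P :=
  P.smul_mem_iff_of_isUnit (IsLocalization.map_units _ s)

/-- If `N` is a gsdf-absorbing submodule of `M` and `S⁻¹N ≠ S⁻¹M`, then `S⁻¹N` is a
gsdf-absorbing submodule of the `S⁻¹R`-module `S⁻¹M`. -/
theorem localized_gsdf {R : Type*} [CommRing R] {M : Type*} [AddCommGroup M] [Module R M]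
    (S : Submonoid R) (N : Submodule R M) (hN : N ≠ ⊤)
    (hgsdf : IsGsdfAbsorbing N)
    (hne : N.localized S ≠ (⊤ : Submodule (Localization S) (LocalizedModule S M))) :
    IsGsdfAbsorbing (N.localized S) := by
  refine ⟨hne, fun u v x h => ?_⟩
  obtain ⟨a, s, rfl⟩ := IsLocalization.exists_mk'_eq S u
  obtain ⟨b, t, rfl⟩ := IsLocalization.exists_mk'_eq S v
  obtain ⟨⟨m, r⟩, hx⟩ := IsLocalizedModule.surj S (LocalizedModule.mkLinearMap S M) x
  have hx' : algebraMap R (Localization S) r • x = LocalizedModule.mkLinearMap S M m := by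
    rw [algebraMap_smul]; exact hx
  set u := IsLocalization.mk' (Localization S) a s
  set v := IsLocalization.mk' (Localization S) b t
  have hu : u * algebraMap R (Localization S) s = algebraMap R _ a :=
    IsLocalization.mk'_spec _ a s
  have hv : v * algebraMap R (Localization S) t = algebraMap R _ b :=
    IsLocalization.mk'_spec _ b t
  have key : ∀ (c : Localization S) (d : R) (w : S),
      algebraMap R (Localization S) w * c = algebraMap R _ d →
      (c • x ∈ N.localized S ↔ ∃ t : S, (t : R) • d • m ∈ N) := by
    intro c d w hc
    rw [← gsdf_aux_mem, map_smul, ← hx', ← algebraMap_smul (Localization S) d, ← hc,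
      smul_comm, gsdf_aux_unit, mul_smul, gsdf_aux_unit]
  obtain ⟨q, hq⟩ := (key _ ((a * t) ^ 2 - (b * s) ^ 2) ((s * t) ^ 2) (by
    simp only [map_sub, map_pow, map_mul, ← hu, ← hv, SubmonoidClass.coe_pow,
      Submonoid.coe_mul]
    ring)).1 h
  rw [smul_comm] at hq
  rcases hgsdf.2 _ _ _ hq with h1 | ⟨k, hk, h1⟩
  · left
    rw [smul_comm] at h1
    refine (key _ (a * t - b * s) (s * t) ?_).2 ⟨q, h1⟩
    simp only [map_sub, map_mul, ← hu, ← hv, Submonoid.coe_mul]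
    ring
  · right
    rw [smul_comm] at h1
    refine ⟨k, hk, (key _ ((a * t + b * s) ^ k) ((s * t) ^ k) ?_).2 ⟨q, h1⟩⟩
    simp only [map_add, map_pow, map_mul, ← hu, ← hv, SubmonoidClass.coe_pow,
      Submonoid.coe_mul]
    rw [← mul_pow]
    congr 1
    ring
end

section
/- Let R be a commutative ring, S a multiplicatively closed subset of R, M an R-module, and N a proper submodule of M. If S⁻¹N is a gsdf-absorbing submodule of the S⁻¹R-module S⁻¹M and N is S-saturated (i.e., for all s ∈ S and x ∈ M, sx ∈ N implies x ∈ N), then N is a gsdf-absorbing submodule of M. -/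
/-- If `S⁻¹N` is a gsdf-absorbing submodule of `S⁻¹M` and `N` is `S`-saturated, then `N` is a
gsdf-absorbing submodule of `M`. -/
theorem gsdf_of_localized_gsdf_of_saturated {R : Type*} [CommRing R] {M : Type*}
    [AddCommGroup M] [Module R M] (S : Submonoid R) (N : Submodule R M) (hN : N ≠ ⊤)
    (hsat : ∀ s ∈ S, ∀ x : M, s • x ∈ N → x ∈ N)
    (hloc : IsGsdfAbsorbing (N.localized S)) :
    IsGsdfAbsorbing N := by
  have key : ∀ y : M, LocalizedModule.mkLinearMap S M y ∈ N.localized S ↔ y ∈ N := by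
    intro y
    constructor
    · intro h
      obtain ⟨m, hm, s, hs⟩ := (Submodule.mem_localized' _ S _ N _).1 h
      rw [IsLocalizedModule.mk'_eq_iff, Submonoid.smul_def, ← map_smul,
        IsLocalizedModule.eq_iff_exists S] at hs
      obtain ⟨c, hc⟩ := hs
      apply hsat s s.2
      apply hsat c c.2
      have h2 : c • m ∈ N := N.smul_mem (c : R) hm
      rw [hc] at h2
      exact h2
    · intro h
      exact (Submodule.mem_localized' _ S _ N _).2 ⟨y, h, 1, by simp⟩
  have sm : ∀ (a : R) (y : M), algebraMap R (Localization S) a •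
      LocalizedModule.mkLinearMap S M y ∈ N.localized S ↔ a • y ∈ N := by
    intro a y
    rw [algebraMap_smul, ← map_smul, key]
  refine ⟨hN, fun u v x h => ?_⟩
  have := hloc.2 (algebraMap R _ u) (algebraMap R _ v) (LocalizedModule.mkLinearMap S M x)
  simp only [← map_pow, ← map_sub, ← map_add, sm] at this
  exact this h
end

section
/- Let R be a commutative ring, M and M′ R-modules, and f : M → M′ a surjective R-module homomorphism. If N is a gsdf-absorbing submodule of M with ker(f) ⊆ N, then f(N) is a gsdf-absorbing submodule of M′. -/
/-- If `f : M → M′` is a surjective `R`-module homomorphism and `N` is a gsdf-absorbing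
submodule of `M` with `ker f ⊆ N`, then `f(N)` is a gsdf-absorbing submodule of `M′`. -/
theorem map_gsdf {R : Type*} [CommRing R] {M M' : Type*}
    [AddCommGroup M] [Module R M] [AddCommGroup M'] [Module R M']
    (f : M →ₗ[R] M') (hf : Function.Surjective f)
    (N : Submodule R M) (hker : LinearMap.ker f ≤ N)
    (hN : IsGsdfAbsorbing N) :
    IsGsdfAbsorbing (N.map f) := by
  have key : ∀ y : M, f y ∈ N.map f ↔ y ∈ N := by
    intro y
    constructor
    · rintro ⟨z, hz, hzy⟩
      have h1 : y - z ∈ N := hker (by rw [LinearMap.mem_ker, map_sub, hzy, sub_self])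
      have h2 := N.add_mem h1 hz
      rwa [sub_add_cancel] at h2
    · exact fun h => Submodule.mem_map_of_mem h
  obtain ⟨hp, hN⟩ := hN
  refine ⟨fun htop => hp ?_, fun u v x' hx => ?_⟩
  · rw [eq_top_iff]
    intro y _
    rw [← key y, htop]
    exact Submodule.mem_top
  · obtain ⟨x, rfl⟩ := hf x'
    simp only [← map_smul, key] at hx ⊢
    exact hN u v x hx
end

section
/- Let R be a commutative ring, M an R-module, and K ⊆ N proper submodules of M. Then N is a gsdf-absorbing submodule of M if and only if N/K is a gsdf-absorbing submodule of the quotient R-module M/K. -/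
/-- For proper submodules `K ⊆ N` of `M`, `N` is gsdf-absorbing in `M` iff `N/K` is a
gsdf-absorbing submodule of `M/K`. -/
theorem gsdf_iff_quotient_gsdf {R : Type*} [CommRing R] {M : Type*}
    [AddCommGroup M] [Module R M] (K N : Submodule R M)
    (hKN : K ≤ N) (hK : K ≠ ⊤) (hN : N ≠ ⊤) :
    IsGsdfAbsorbing N ↔ IsGsdfAbsorbing (N.map K.mkQ) := by
  have key : ∀ y : M, K.mkQ y ∈ N.map K.mkQ ↔ y ∈ N := by
    intro y
    rw [← Submodule.mem_comap, Submodule.comap_map_mkQ, sup_eq_right.mpr hKN]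
  constructor
  · rintro ⟨-, h⟩
    refine ⟨fun ht => hN ?_, ?_⟩
    · rw [Submodule.eq_top_iff']
      intro y
      rw [← key y, ht]
      trivial
    · intro u v x hx
      obtain ⟨y, rfl⟩ := K.mkQ_surjective x
      simp only [← map_smul, key] at hx ⊢
      exact h u v y hx
  · rintro ⟨-, h⟩
    refine ⟨hN, fun u v x hx => ?_⟩
    have := h u v (K.mkQ x)
    simp only [← map_smul, key] at this
    exact this hx
end

section
/- Let n ≥ 2 be an integer. The submodule nℤ of the ℤ-module ℤ is gsdf-absorbing if and only if n = p^k for some prime p and integer k ≥ 1, or n = 2p^k for some odd prime p and integer k ≥ 1. -/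
theorem gsdf_aux (n : ℕ) (hn : 2 ≤ n) (p k : ℕ) (hp : p.Prime) (hk : 1 ≤ k)
    (h : n = p ^ k ∨ n = 2 * p ^ k ∧ Odd p) :
    IsGsdfAbsorbing (Ideal.span {(n : ℤ)} : Submodule ℤ ℤ) := by
  refine ⟨?_, ?_⟩
  · intro ht
    have h1 : (1 : ℤ) ∈ (Ideal.span {(n : ℤ)} : Submodule ℤ ℤ) := by rw [ht]; trivial
    rw [Ideal.mem_span_singleton] at h1
    have := Int.le_of_dvd one_pos h1
    omega
  · intro u v x hx
    rw [Ideal.mem_span_singleton] at hx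
    simp only [Ideal.mem_span_singleton, smul_eq_mul] at hx ⊢
    have hpp : Prime (p : ℤ) := Nat.prime_iff_prime_int.mp hp
    have hpn : ((p : ℤ) ^ k) ∣ (n : ℤ) := by
      rcases h with h | ⟨h, _⟩ <;> rw [h] <;> push_cast
      · exact dvd_rfl
      · exact dvd_mul_left _ _
    have hpx := hpn.trans hx
    have comb : ∀ y : ℤ, (p : ℤ) ^ k ∣ y → ((2 : ℤ) ∣ (u ^ 2 - v ^ 2) * x → (2 : ℤ) ∣ y) →
        (n : ℤ) ∣ y := by
      intro y h1 h2
      rcases h with h | ⟨h, ho⟩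
      · rw [h]; push_cast; exact h1
      · have h3 : (2 : ℤ) ∣ y := h2 ((show (2 : ℤ) ∣ (n : ℤ) by
          rw [h]; push_cast; exact dvd_mul_right _ _).trans hx)
        rw [h]; push_cast
        refine IsCoprime.mul_dvd ?_ h3 h1
        have : IsCoprime ((2 : ℕ) : ℤ) ((p ^ k : ℕ) : ℤ) := by
          rw [Nat.isCoprime_iff_coprime]
          exact (Nat.coprime_two_left.mpr (ho.pow))
        push_cast at this; exact this
    by_cases hd : (p : ℤ) ∣ u + v
    · right
      refine ⟨k, hk, comb _ (Dvd.dvd.mul_right (pow_dvd_pow_of_dvd hd k) x) ?_⟩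
      have hk0 : k ≠ 0 := by omega
      simp only [← even_iff_two_dvd]
      intro h
      simp [parity_simps, hk0] at h ⊢
      tauto
    · left
      refine comb _ ?_ ?_
      · have : (u ^ 2 - v ^ 2) * x = (u + v) * ((u - v) * x) := by ring
        rw [this] at hpx
        exact hpp.pow_dvd_of_dvd_mul_left k hd hpx
      · simp only [← even_iff_two_dvd]
        intro h
        simp [parity_simps] at h ⊢
        tauto

/-- The submodule `nℤ` of the `ℤ`-module `ℤ` is gsdf-absorbing iff `n = p^k` with `p` prime and
`k ≥ 1`, or `n = 2 * p^k` with `p` an odd prime and `k ≥ 1`. -/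
theorem nZ_gsdf_iff (n : ℕ) (hn : 2 ≤ n) :
    IsGsdfAbsorbing (Ideal.span {(n : ℤ)} : Submodule ℤ ℤ) ↔
      (∃ p k : ℕ, p.Prime ∧ 1 ≤ k ∧ n = p ^ k) ∨
      (∃ p k : ℕ, p.Prime ∧ Odd p ∧ 1 ≤ k ∧ n = 2 * p ^ k) := by
  constructor
  · rintro ⟨-, H⟩
    by_cases h2 : ∃ p : ℕ, p.Prime ∧ p ∣ n ∧ p ≠ 2
    · obtain ⟨p, hp, hpn, hp2⟩ := h2
      obtain ⟨k, b, hb, hnb⟩ := Nat.exists_eq_pow_mul_and_not_dvd (n := n) (by omega) p hp.ne_one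
      have ho : Odd p := hp.odd_of_ne_two hp2
      have hk : 1 ≤ k := by
        by_contra hk
        have : k = 0 := by omega
        subst this
        simp at hnb
        exact hb (hnb ▸ hpn)
      have hppos : 0 < p ^ k := pow_pos hp.pos k
      have hb2 : b ∣ 2 := by
        have h := H ((p : ℤ) ^ k + b) (b - (p : ℤ) ^ k) 1
        simp only [Ideal.mem_span_singleton, smul_eq_mul, mul_one] at h
        rcases h ⟨4, by rw [hnb]; push_cast; ring⟩ with h | ⟨j, hj, h⟩
        · have h' : n ∣ 2 * p ^ k := by
            have e : (p : ℤ) ^ k + b - (b - (p : ℤ) ^ k) = ((2 * p ^ k : ℕ) : ℤ) := by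
              push_cast; ring
            rw [e] at h
            exact Int.natCast_dvd_natCast.mp h
          rw [hnb, mul_comm] at h'
          exact Nat.dvd_of_mul_dvd_mul_right hppos h'
        · exfalso
          have h' : n ∣ (2 * b) ^ j := by
            have e : ((p : ℤ) ^ k + b + (b - (p : ℤ) ^ k)) ^ j = (((2 * b) ^ j : ℕ) : ℤ) := by
              push_cast; congr 1; ring
            rw [e] at h
            exact Int.natCast_dvd_natCast.mp h
          have h3 := hp.dvd_of_dvd_pow (hpn.trans h')
          rcases hp.dvd_mul.mp h3 with h3 | h3
          · exact hp2 ((Nat.prime_dvd_prime_iff_eq hp Nat.prime_two).mp h3)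
          · exact hb h3
      rcases (Nat.dvd_prime Nat.prime_two).mp hb2 with rfl | rfl
      · exact Or.inl ⟨p, k, hp, hk, by simpa using hnb⟩
      · exact Or.inr ⟨p, k, hp, ho, hk, by rw [hnb, mul_comm]⟩
    · push Not at h2
      have := Nat.eq_prime_pow_of_unique_prime_dvd (n := n) (p := 2) (by omega)
        (fun {d} hd hdn => h2 d hd hdn)
      refine Or.inl ⟨2, _, Nat.prime_two, ?_, this⟩
      by_contra hk
      have h0 : n.primeFactorsList.length = 0 := by omega
      rw [h0] at this
      omega
  · rintro (⟨p, k, hp, hk, h⟩ | ⟨p, k, hp, ho, hk, h⟩)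
    · exact gsdf_aux n hn p k hp hk (Or.inl h)
    · exact gsdf_aux n hn p k hp hk (Or.inr ⟨h, ho⟩)
end

section
/- Let R be a commutative ring, M₁ and M₂ R-modules, and N₁, N₂ proper submodules of M₁ and M₂ respectively. If N₁ × N₂ is a gsdf-absorbing submodule of the R-module M₁ × M₂, then N₁ is a gsdf-absorbing submodule of M₁ and N₂ is a gsdf-absorbing submodule of M₂. -/
/-- If `N₁ × N₂` is a gsdf-absorbing submodule of `M₁ × M₂`, then `N₁` and `N₂` are
gsdf-absorbing submodules of `M₁` and `M₂` respectively. -/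
theorem gsdf_of_prod_gsdf {R : Type*} [CommRing R] {M₁ M₂ : Type*}
    [AddCommGroup M₁] [Module R M₁] [AddCommGroup M₂] [Module R M₂]
    (N₁ : Submodule R M₁) (N₂ : Submodule R M₂) (h₁ : N₁ ≠ ⊤) (h₂ : N₂ ≠ ⊤)
    (h : IsGsdfAbsorbing (N₁.prod N₂)) :
    IsGsdfAbsorbing N₁ ∧ IsGsdfAbsorbing N₂ := by
  refine ⟨⟨h₁, fun u v x hx => ?_⟩, ⟨h₂, fun u v x hx => ?_⟩⟩
  · rcases h.2 u v (x, 0) (by simpa [Submodule.mem_prod] using hx) with h' | ⟨k, hk, h'⟩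
    · exact Or.inl h'.1
    · exact Or.inr ⟨k, hk, h'.1⟩
  · rcases h.2 u v (0, x) (by simpa [Submodule.mem_prod] using hx) with h' | ⟨k, hk, h'⟩
    · exact Or.inl h'.2
    · exact Or.inr ⟨k, hk, h'.2⟩
end

section
/- Let R be a commutative ring, M₁ and M₂ R-modules, and N₁ a proper submodule of M₁. Then N₁ × M₂ is a gsdf-absorbing submodule of the R-module M₁ × M₂ if and only if N₁ is a gsdf-absorbing submodule of M₁. -/
/-- `N₁ × M₂` is a gsdf-absorbing submodule of `M₁ × M₂` iff `N₁` is a gsdf-absorbing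
submodule of `M₁`. -/
theorem prod_top_gsdf_iff {R : Type*} [CommRing R] {M₁ M₂ : Type*}
    [AddCommGroup M₁] [Module R M₁] [AddCommGroup M₂] [Module R M₂]
    (N₁ : Submodule R M₁) (h₁ : N₁ ≠ ⊤) :
    IsGsdfAbsorbing (N₁.prod (⊤ : Submodule R M₂)) ↔ IsGsdfAbsorbing N₁ := by
  have hm : ∀ (x : M₁ × M₂), x ∈ N₁.prod (⊤ : Submodule R M₂) ↔ x.1 ∈ N₁ := by
    intro x
    simp [Submodule.mem_prod]
  constructor
  · rintro ⟨_, h⟩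
    refine ⟨h₁, fun u v x hx => ?_⟩
    have := h u v (x, 0) ((hm _).2 hx)
    simpa only [hm, Prod.smul_fst] using this
  · rintro ⟨_, h⟩
    refine ⟨fun ht => h₁ ?_, fun u v x hx => ?_⟩
    · rw [eq_top_iff]
      intro x _
      have hx : ((x, 0) : M₁ × M₂) ∈ N₁.prod (⊤ : Submodule R M₂) := by
        rw [ht]
        trivial
      exact (hm _).1 hx
    · have := h u v x.1 ((hm _).1 hx)
      simpa only [hm, Prod.smul_fst] using this
end

section
/- Let R be a commutative ring, M an R-module, I a proper ideal of R, and N a submodule of M with IM ⊆ N (so that I ⋉ N = {(r, x) : r ∈ I, x ∈ N} is an ideal of the idealization R ⋉ M). If I ⋉ N is an sdf-absorbing primary ideal of R ⋉ M, then I is an sdf-absorbing primary ideal of R. -/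
/-- Given an ideal `I` of `R` and a submodule `N` of `M` with `IM ⊆ N`, the set
`I ⋉ N = {(r, x) : r ∈ I, x ∈ N}` is an ideal of the idealization `R ⋉ M`. -/
def idealizationIdeal {R : Type*} [CommRing R] {M : Type*} [AddCommGroup M] [Module R M]
    [Module Rᵐᵒᵖ M] [IsCentralScalar R M] (I : Ideal R) (N : Submodule R M)
    (hIM : ∀ r ∈ I, ∀ m : M, r • m ∈ N) : Ideal (TrivSqZeroExt R M) where
  carrier := {p : TrivSqZeroExt R M | p.fst ∈ I ∧ p.snd ∈ N}
  zero_mem' := ⟨by simp, by simp⟩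
  add_mem' := fun {p q} hp hq =>
    ⟨by simpa using I.add_mem hp.1 hq.1, by simpa using N.add_mem hp.2 hq.2⟩
  smul_mem' := fun c p hp => by
    refine ⟨?_, ?_⟩
    · rw [smul_eq_mul, TrivSqZeroExt.fst_mul]
      exact I.mul_mem_left c.fst hp.1
    · rw [smul_eq_mul, TrivSqZeroExt.snd_mul, op_smul_eq_smul]
      exact N.add_mem (N.smul_mem c.fst hp.2) (hIM p.fst hp.1 c.snd)

/-- If `I ⋉ N` is an sdf-absorbing primary ideal of `R ⋉ M`, then `I` is an sdf-absorbing
primary ideal of `R`. -/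
theorem sdf_primary_of_idealization {R : Type*} [CommRing R] {M : Type*}
    [AddCommGroup M] [Module R M] [Module Rᵐᵒᵖ M] [IsCentralScalar R M]
    (I : Ideal R) (hI : I ≠ ⊤) (N : Submodule R M)
    (hIM : ∀ r ∈ I, ∀ m : M, r • m ∈ N)
    (h : IsSdfAbsorbingPrimary (idealizationIdeal I N hIM)) :
    IsSdfAbsorbingPrimary I := by
  refine ⟨hI, fun u v huv => ?_⟩
  have key : (TrivSqZeroExt.inl u : TrivSqZeroExt R M) ^ 2 - TrivSqZeroExt.inl v ^ 2
      ∈ idealizationIdeal I N hIM := by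
    rw [TrivSqZeroExt.inl_pow, TrivSqZeroExt.inl_pow, ← TrivSqZeroExt.inl_sub]
    exact ⟨huv, N.zero_mem⟩
  rcases h.2 _ _ key with h1 | ⟨k, hk, h2⟩
  · left
    simpa using h1.1
  · right
    exact ⟨k, hk, by simpa using h2.1⟩
end

section
/- Let R be a commutative ring, M an R-module, and I a proper ideal of R. Then I is an sdf-absorbing primary ideal of R if and only if I ⋉ M = {(r, x) : r ∈ I, x ∈ M} is an sdf-absorbing primary ideal of the idealization R ⋉ M. -/
/-- Given an ideal `I` of `R`, the set `I ⋉ M = {(r, x) : r ∈ I, x ∈ M}` is an ideal of the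
idealization `R ⋉ M`. -/
def idealizationTopIdeal {R : Type*} [CommRing R] {M : Type*} [AddCommGroup M] [Module R M]
    [Module Rᵐᵒᵖ M] [IsCentralScalar R M] (I : Ideal R) : Ideal (TrivSqZeroExt R M) where
  carrier := {p : TrivSqZeroExt R M | p.fst ∈ I}
  zero_mem' := by simp
  add_mem' := fun {p q} hp hq => by simpa using I.add_mem hp hq
  smul_mem' := fun c p hp => by
    simpa [smul_eq_mul, TrivSqZeroExt.fst_mul] using I.mul_mem_left c.fst hp

/-- `I` is an sdf-absorbing primary ideal of `R` iff `I ⋉ M` is an sdf-absorbing primary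
ideal of the idealization `R ⋉ M`. -/
theorem sdf_primary_iff_idealization_top {R : Type*} [CommRing R] {M : Type*}
    [AddCommGroup M] [Module R M] [Module Rᵐᵒᵖ M] [IsCentralScalar R M]
    (I : Ideal R) (hI : I ≠ ⊤) :
    IsSdfAbsorbingPrimary I ↔
      IsSdfAbsorbingPrimary (idealizationTopIdeal (M := M) I) := by
  have hmem : ∀ p : TrivSqZeroExt R M, p ∈ idealizationTopIdeal (M := M) I ↔ p.fst ∈ I :=
    fun p => Iff.rfl
  have hne : idealizationTopIdeal (M := M) I ≠ ⊤ := by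
    rw [Ideal.ne_top_iff_one, hmem, TrivSqZeroExt.fst_one]
    exact (Ideal.ne_top_iff_one I).1 hI
  constructor
  · rintro ⟨-, h⟩
    refine ⟨hne, fun u v huv => ?_⟩
    simp only [hmem, TrivSqZeroExt.fst_sub, TrivSqZeroExt.fst_pow, TrivSqZeroExt.fst_add]
      at huv ⊢
    exact h _ _ huv
  · rintro ⟨-, h⟩
    refine ⟨hI, fun u v huv => ?_⟩
    have := h (TrivSqZeroExt.inl u) (TrivSqZeroExt.inl v)
    simp only [hmem, TrivSqZeroExt.fst_sub, TrivSqZeroExt.fst_pow, TrivSqZeroExt.fst_add,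
      TrivSqZeroExt.fst_inl] at this
    exact this huv
end
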